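/- With the rank and envelope notation below and α ∈ (0,1), the 100(1−α)% global extreme rank length envelope is contained in the 100(1−α)% global rank envelope: for every k ∈ {1,…,d}, V_{low,k}^{(α)} ≥ V_{low,k}^{(l_α)} and V_{upp,k}^{(α)} ≤ V_{upp,k}^{(l_α)}, where l_α = max{ l ∈ ℕ, l ≥ 1 : #{ i : R_i < l } ≤ αs }, V_{low,k}^{(l_α)} is the l_α-th smallest and V_{upp,k}^{(l_α)} the l_α-th largest of V_{1k}, …, V_{sk}. -/

import Mathlib

/-- The raw rank `r_{ik}`: the number of indices `i′` with `V_{i′k} ≤ V_{ik}` (so the smallest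
value in coordinate `k` has raw rank 1, assuming no pointwise ties). -/
noncomputable def rawRank {s d : ℕ} (V : Fin s → Fin d → ℝ) (i : Fin s) (k : Fin d) : ℕ :=
  Nat.card {i' : Fin s // V i' k ≤ V i k}

/-- The two-sided pointwise rank `R_{ik} = min(r_{ik}, s + 1 − r_{ik})`. -/
noncomputable def ptwRank {s d : ℕ} (V : Fin s → Fin d → ℝ) (i : Fin s) (k : Fin d) : ℕ :=
  min (rawRank V i k) (s + 1 - rawRank V i k)

/-- The extreme rank `R_i = min_{k} R_{ik}`. -/
noncomputable def extremeRank {s d : ℕ} (V : Fin s → Fin d → ℝ) (i : Fin s) : ℕ :=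
  ⨅ k : Fin d, ptwRank V i k

/-- The sorted rank vector `𝐑_i`: the nondecreasing rearrangement of `(R_{i1}, …, R_{id})`. -/
noncomputable def sortedRank {s d : ℕ} (V : Fin s → Fin d → ℝ) (i : Fin s) : Fin d → ℕ :=
  fun k => ptwRank V i (Tuple.sort (ptwRank V i) k)

/-- Strict lexicographic order on (sorted) rank vectors: `a ≺ b` iff there exists `n` with
`a k = b k` for all `k < n` and `a n < b n`. -/
def lexLT {d : ℕ} (a b : Fin d → ℕ) : Prop :=
  ∃ n : Fin d, (∀ k : Fin d, k < n → a k = b k) ∧ a n < b n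

/-- `s` times the extreme rank length measure: the number of indices `i′` with `𝐑_{i′} ≺ 𝐑_i`. -/
noncomputable def erlCount {s d : ℕ} (V : Fin s → Fin d → ℝ) (i : Fin s) : ℕ :=
  Nat.card {i' : Fin s // lexLT (sortedRank V i') (sortedRank V i)}

/-- The extreme rank length measure `R_i^{erl} = (1/s)·#{ i′ : 𝐑_{i′} ≺ 𝐑_i }`. -/
noncomputable def erl {s d : ℕ} (V : Fin s → Fin d → ℝ) (i : Fin s) : ℝ :=
  (erlCount V i : ℝ) / s

theorem lexLT_irrefl {d : ℕ} (a : Fin d → ℕ) : ¬ lexLT a a := fun ⟨_, _, h⟩ => lt_irrefl _ h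

theorem lexLT_trans {d : ℕ} {a b c : Fin d → ℕ} (hab : lexLT a b) (hbc : lexLT b c) :
    lexLT a c := by
  obtain ⟨n, hn, hn'⟩ := hab
  obtain ⟨m, hm, hm'⟩ := hbc
  rcases lt_trichotomy n m with h | h | h
  · exact ⟨n, fun k hk => (hn k hk).trans (hm k (hk.trans h)), hm n h ▸ hn'⟩
  · subst h
    exact ⟨n, fun k hk => (hn k hk).trans (hm k hk), hn'.trans hm'⟩
  · exact ⟨m, fun k hk => (hn k (hk.trans h)).trans (hm k hk), (hn m h).symm ▸ hm'⟩

theorem extremeRank_le_ptwRank {s d : ℕ} (V : Fin s → Fin d → ℝ) (i : Fin s) (k : Fin d) :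
    extremeRank V i ≤ ptwRank V i k :=
  ciInf_le (OrderBot.bddBelow _) k

theorem sortedRank_zero {s d : ℕ} (hd : 0 < d) (V : Fin s → Fin d → ℝ) (i : Fin s) :
    sortedRank V i ⟨0, hd⟩ = extremeRank V i := by
  have : Nonempty (Fin d) := ⟨⟨0, hd⟩⟩
  refine le_antisymm (le_ciInf fun k => ?_) (extremeRank_le_ptwRank V i _)
  have h := Tuple.monotone_sort (ptwRank V i)
    (show (⟨0, hd⟩ : Fin d) ≤ (Tuple.sort (ptwRank V i)).symm k from Nat.zero_le _)
  simpa [sortedRank] using h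

theorem lexLT_sortedRank_of_extremeRank_lt {s d : ℕ} (hd : 0 < d) {V : Fin s → Fin d → ℝ}
    {i j : Fin s} (h : extremeRank V i < extremeRank V j) :
    lexLT (sortedRank V i) (sortedRank V j) := by
  refine ⟨⟨0, hd⟩, fun k hk => absurd hk (Nat.not_lt_zero _), ?_⟩
  rwa [sortedRank_zero, sortedRank_zero]

theorem natCard_subtype_lt {β : Type*} [Finite β] {p q : β → Prop} (hpq : ∀ x, p x → q x)
    {a : β} (hp : ¬ p a) (hq : q a) : Nat.card {x // p x} < Nat.card {x // q x} :=
  Set.ncard_lt_ncard (s := {x | p x}) (t := {x | q x}) ⟨hpq, fun h => hp (h hq)⟩ (Set.toFinite _)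

theorem erl_lt_erl_of_lexLT {s d : ℕ} {V : Fin s → Fin d → ℝ} {i j : Fin s}
    (h : lexLT (sortedRank V i) (sortedRank V j)) : erl V i < erl V j := by
  have hs : (0 : ℝ) < s := by exact_mod_cast i.pos
  have hcard : erlCount V i < erlCount V j :=
    natCard_subtype_lt (fun _ hx => lexLT_trans hx h) (lexLT_irrefl _) h
  exact div_lt_div_of_pos_right (by exact_mod_cast hcard) hs

/-- Every index whose extreme rank length measure reaches the critical value `c` has extreme
rank at least `l`, whenever at most `αs` indices have extreme rank below `l`. -/
theorem le_extremeRank_of_le_erl {s d : ℕ} (hs : 0 < s) (hd : 0 < d) {α : ℝ} (hα : α < 1)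
    {V : Fin s → Fin d → ℝ} {c : ℝ}
    (hc_max : ∀ i : Fin s,
      (Nat.card {i' : Fin s // erl V i' < erl V i} : ℝ) ≤ α * s → erl V i ≤ c)
    {l : ℕ} (hl : (Nat.card {i : Fin s // extremeRank V i < l} : ℝ) ≤ α * s)
    {i : Fin s} (hi : c ≤ erl V i) : l ≤ extremeRank V i := by
  by_contra! hlt
  have hne : {j : Fin s | l ≤ extremeRank V j}.Nonempty := by
    by_contra hempty
    have hall : ∀ j : Fin s, extremeRank V j < l := fun j =>
      not_le.mp fun hj => hempty ⟨j, hj⟩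
    have hcard : Nat.card {i : Fin s // extremeRank V i < l} = s := by
      rw [Nat.card_congr (Equiv.subtypeUnivEquiv hall), Nat.card_fin]
    rw [hcard] at hl
    have : (0 : ℝ) < s := by exact_mod_cast hs
    nlinarith
  obtain ⟨j, hj, hmin⟩ := Set.exists_min_image _ (erl V) (Set.toFinite _) hne
  have hsub : Nat.card {i' : Fin s // erl V i' < erl V j} ≤
      Nat.card {i : Fin s // extremeRank V i < l} :=
    Set.ncard_le_ncard (s := {i' | erl V i' < erl V j}) (t := {i | extremeRank V i < l})
      (fun x hx => lt_of_not_ge (b := l) fun hxl => (hmin x hxl).not_gt hx) (Set.toFinite _)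
  have hjc : erl V j ≤ c := hc_max j (le_trans (by exact_mod_cast hsub) hl)
  have hij := erl_lt_erl_of_lexLT (lexLT_sortedRank_of_extremeRank_lt hd (hlt.trans_le hj))
  linarith

/-- Without ties, `s + 1 - r_{ik}` is the rank of `V_{ik}` counted from above. -/
theorem natCard_ge_add_rawRank {s d : ℕ} {V : Fin s → Fin d → ℝ} {k : Fin d}
    (hk : Function.Injective fun i => V i k) (i : Fin s) :
    Nat.card {j : Fin s // V i k ≤ V j k} + rawRank V i k = s + 1 := by
  have h := Set.ncard_union_add_ncard_inter {j | V i k ≤ V j k} {j | V j k ≤ V i k}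
  have hunion : {j | V i k ≤ V j k} ∪ {j | V j k ≤ V i k} = Set.univ :=
    Set.eq_univ_of_forall fun j => le_total (V i k) (V j k)
  have hinter : {j | V i k ≤ V j k} ∩ {j | V j k ≤ V i k} = {i} := by
    ext j
    refine ⟨fun hj => hk (le_antisymm hj.2 hj.1), ?_⟩
    rintro rfl
    exact ⟨le_refl (V j k), le_refl (V j k)⟩
  rw [hunion, hinter, Set.ncard_univ, Nat.card_fin, Set.ncard_singleton] at h
  exact h.symm

/-- Theorem 2: the `100(1−α)%` global extreme rank length envelope is contained in the
`100(1−α)%` global rank envelope. Here `c` is the critical value `R_{(α)}^{erl}`, the envelope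
`[V_{low,k}^{(α)}, V_{upp,k}^{(α)}]` is spanned by `I_α = {i : R_i^{erl} ≥ c}`, `lα` is the
critical rank of the global rank envelope (the largest `l ≥ 1` with `#{i : R_i < l} ≤ αs`), and
`Vlow k`/`Vupp k` are the `lα`-th smallest/largest of `V_{1k}, …, V_{sk}`, characterized (under
no pointwise ties) as the data values with exactly `lα` data values `≤`/`≥` them. -/
theorem erl_envelope_subset_rank_envelope {s d : ℕ} (hs : 0 < s) (hd : 0 < d)
    {α : ℝ} (hα : α ∈ Set.Ioo (0 : ℝ) 1)
    (V : Fin s → Fin d → ℝ)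
    (hnoties : ∀ k : Fin d, Function.Injective fun i => V i k)
    (c : ℝ) (hc_mem : ∃ i : Fin s, erl V i = c)
    (hc_le : (Nat.card {i : Fin s // erl V i < c} : ℝ) ≤ α * s)
    (hc_max : ∀ i : Fin s,
      (Nat.card {i' : Fin s // erl V i' < erl V i} : ℝ) ≤ α * s → erl V i ≤ c)
    (lα : ℕ) (hlα1 : 1 ≤ lα)
    (hlα2 : (Nat.card {i : Fin s // extremeRank V i < lα} : ℝ) ≤ α * s)
    (hlα3 : ∀ l : ℕ, 1 ≤ l →
      (Nat.card {i : Fin s // extremeRank V i < l} : ℝ) ≤ α * s → l ≤ lα)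
    (Vlow Vupp : Fin d → ℝ)
    (hVlow : ∀ k : Fin d, (∃ i : Fin s, V i k = Vlow k) ∧
      Nat.card {i : Fin s // V i k ≤ Vlow k} = lα)
    (hVupp : ∀ k : Fin d, (∃ i : Fin s, V i k = Vupp k) ∧
      Nat.card {i : Fin s // Vupp k ≤ V i k} = lα) :
    ∀ k : Fin d,
      Vlow k ≤ sInf ((fun i => V i k) '' {i : Fin s | c ≤ erl V i}) ∧
        sSup ((fun i => V i k) '' {i : Fin s | c ≤ erl V i}) ≤ Vupp k := by
  have key : ∀ i k, c ≤ erl V i → lα ≤ ptwRank V i k := fun i k hi =>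
    (le_extremeRank_of_le_erl hs hd hα.2 hc_max hlα2 hi).trans (extremeRank_le_ptwRank V i k)
  obtain ⟨i₀, hi₀⟩ := hc_mem
  intro k
  have hne : ((fun i => V i k) '' {i : Fin s | c ≤ erl V i}).Nonempty := ⟨_, i₀, hi₀.ge, rfl⟩
  obtain ⟨⟨a, ha⟩, hlow⟩ := hVlow k
  obtain ⟨⟨b, hb⟩, hupp⟩ := hVupp k
  refine ⟨le_csInf hne ?_, csSup_le hne ?_⟩
  · rintro _ ⟨i, hi, rfl⟩
    by_contra! hlt
    have hcard : rawRank V i k < Nat.card {i : Fin s // V i k ≤ Vlow k} :=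
      natCard_subtype_lt (fun _ hx => hx.trans hlt.le) (ha ▸ hlt.not_ge) ha.le
    have hrank : lα ≤ rawRank V i k := (key i k hi).trans (min_le_left _ _)
    omega
  · rintro _ ⟨i, hi, rfl⟩
    by_contra! hlt
    have hcard : Nat.card {j : Fin s // V i k ≤ V j k} <
        Nat.card {i : Fin s // Vupp k ≤ V i k} :=
      natCard_subtype_lt (fun _ hx => hlt.le.trans hx) (hb ▸ hlt.not_ge) hb.ge
    have hrank : lα ≤ s + 1 - rawRank V i k := (key i k hi).trans (min_le_right _ _)
    have hsum := natCard_ge_add_rawRank (hnoties k) i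
    omega
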